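/- arXiv:0803.2800 — 3 statements merged into one kernel-verified Lean document; each statement's English description precedes it below -/
import Mathlib

section
/- Let 𝔤 be a finite-dimensional Lie algebra over a field whose centroid Cent(𝔤) is commutative (for instance, 𝔤 perfect or centerfree). Then there exist n ∈ ℕ and nonzero ideals 𝔤₁, …, 𝔤ₙ of 𝔤, each of which is an indecomposable Lie algebra, such that 𝔤 is the internal direct sum 𝔤 = 𝔤₁ ⊕ … ⊕ 𝔤ₙ; moreover this decomposition is unique except for the order: if 𝔥₁, …, 𝔥ₘ is another family of nonzero ideals, each indecomposable as a Lie algebra, with 𝔤 = 𝔥₁ ⊕ … ⊕ 𝔥ₘ an internal direct sum, then m = n and {𝔤₁, …, 𝔤ₙ} = {𝔥₁, …, 𝔥ₘ} as sets of ideals. -/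
/-- For a Lie algebra `L` over `K`, membership of a linear endomorphism in the centroid. -/
def InCentroid {K L : Type*} [CommRing K] [LieRing L] [LieAlgebra K L]
    (f : Module.End K L) : Prop :=
  ∀ x y : L, f ⁅x, y⁆ = ⁅x, f y⁆

/-- A Lie algebra is indecomposable if it is not the direct sum of two nonzero ideals. -/
def IsIndecomposableLie (K L : Type*) [CommRing K] [LieRing L] [LieAlgebra K L] : Prop :=
  ∀ I J : LieIdeal K L, I ⊓ J = ⊥ → I ⊔ J = ⊤ → I = ⊥ ∨ J = ⊥

section Helpers

variable {K L : Type*} [Field K] [LieRing L] [LieAlgebra K L]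

lemma isCompl_toSub {A B : LieIdeal K L} (h : IsCompl A B) :
    IsCompl (A : Submodule K L) (B : Submodule K L) :=
  ⟨LieSubmodule.disjoint_toSubmodule.mpr h.disjoint,
    LieSubmodule.codisjoint_toSubmodule.mpr h.codisjoint⟩

lemma lie_eq_zero_of_disjoint {A B : LieIdeal K L} (h : Disjoint A B) {a b : L}
    (ha : a ∈ A) (hb : b ∈ B) : ⁅a, b⁆ = 0 := by
  have h1 : ⁅a, b⁆ ∈ A := lie_mem_left K L A a b ha
  have h2 : ⁅a, b⁆ ∈ B := lie_mem_right K L B a b hb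
  have h3 : ⁅a, b⁆ ∈ A ⊓ B := (LieSubmodule.mem_inf _ _ _).mpr ⟨h1, h2⟩
  rw [h.eq_bot] at h3
  simpa using h3

lemma exists_add {A B : LieIdeal K L} (h : IsCompl A B) (x : L) :
    ∃ a ∈ A, ∃ b ∈ B, a + b = x := by
  have : x ∈ A ⊔ B := by rw [h.sup_eq_top]; exact LieSubmodule.mem_top x
  exact (LieSubmodule.mem_sup _ _ _).mp this

lemma proj_add {A B : LieIdeal K L} (h : IsCompl A B) {a b : L} (ha : a ∈ A) (hb : b ∈ B) :
    Submodule.projection _ _ (isCompl_toSub h) (a + b) = a := by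
  rw [map_add, Submodule.projection_apply_of_mem_left _ (by exact ha),
    Submodule.projection_apply_of_mem_right _ (by exact hb), add_zero]

/-- The projection along complementary ideals is in the centroid. -/
lemma proj_inCentroid {A B : LieIdeal K L} (h : IsCompl A B) :
    InCentroid (Submodule.projection _ _ (isCompl_toSub h)) := by
  intro x y
  obtain ⟨a, ha, b, hb, rfl⟩ := exists_add h x
  obtain ⟨c, hc, d, hd, rfl⟩ := exists_add h y
  rw [proj_add h hc hd]
  have e1 : ⁅a + b, c + d⁆ = ⁅a, c⁆ + ⁅b, d⁆ := by
    simp [lie_eq_zero_of_disjoint h.disjoint ha hd, lie_eq_zero_of_disjoint h.disjoint.symm hb hc]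
  have e2 : ⁅a + b, c⁆ = ⁅a, c⁆ := by
    simp [lie_eq_zero_of_disjoint h.disjoint.symm hb hc]
  rw [e1, e2]
  exact proj_add h (lie_mem_right K L A a c hc) (lie_mem_right K L B b d hd)

lemma distrib (hcomm : ∀ f g : Module.End K L, InCentroid f → InCentroid g → f * g = g * f)
    {A B C D : LieIdeal K L} (h : IsCompl A B) (h' : IsCompl C D) :
    (A ⊓ C) ⊔ (A ⊓ D) = A := by
  apply le_antisymm (sup_le inf_le_left inf_le_left)
  intro x hx
  have hc := LinearMap.congr_fun (hcomm _ _ (proj_inCentroid h) (proj_inCentroid h')) x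
  obtain ⟨c, hcC, d, hd, rfl⟩ := exists_add h' x
  rw [Module.End.mul_apply, Module.End.mul_apply, proj_add h' hcC hd,
    Submodule.projection_apply_of_mem_left (isCompl_toSub h) (x := c + d) (by exact hx),
    proj_add h' hcC hd] at hc
  have hcA : c ∈ A := by
    rw [← hc]; exact Submodule.projection_apply_mem (isCompl_toSub h) c
  have hdA : d ∈ A := by
    have := sub_mem hx hcA
    simpa using this
  exact (LieSubmodule.mem_sup _ _ _).mpr ⟨c, (LieSubmodule.mem_inf _ _ _).mpr ⟨hcA, hcC⟩,
    d, (LieSubmodule.mem_inf _ _ _).mpr ⟨hdA, hd⟩, rfl⟩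

/-- Indecomposable nonzero direct factors. -/
def IsFactor (A : LieIdeal K L) : Prop :=
  A ≠ ⊥ ∧ (∃ B, IsCompl A B) ∧
    ∀ C D : LieIdeal K L, Disjoint C D → C ⊔ D = A → C = ⊥ ∨ D = ⊥

lemma indec_of_factor {A : LieIdeal K L} (hA : IsFactor A) : IsIndecomposableLie K A := by
  obtain ⟨-, ⟨B, hB⟩, hA⟩ := hA
  intro I J hIJ hIJ'
  let up : LieIdeal K A → LieIdeal K L := fun I =>
    { (I : Submodule K A).map (A : Submodule K L).subtype with
      lie_mem := by
        rintro x m ⟨c, hc, rfl⟩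
        obtain ⟨a, ha, b, hb, rfl⟩ := exists_add hB x
        let c' : A := c
        let w : A := ⁅(⟨a, ha⟩ : A), c'⁆
        have hw : w ∈ I := lie_mem_right K A I _ _ hc
        refine ⟨w, hw, ?_⟩
        have : ⁅b, (c : L)⁆ = 0 := lie_eq_zero_of_disjoint hB.disjoint.symm hb c.2
        change ⁅a, (c : L)⁆ = ⁅a + b, (c : L)⁆
        rw [add_lie, this, add_zero] }
  have mem_up : ∀ (I : LieIdeal K A) (x : L), x ∈ up I ↔ ∃ c ∈ I, (c : L) = x := by
    intro I x; exact Iff.rfl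
  have up_bot : ∀ I : LieIdeal K A, up I = ⊥ → I = ⊥ := by
    intro I h
    rw [LieSubmodule.eq_bot_iff]
    intro c hc
    have : (c : L) ∈ up I := (mem_up _ _).mpr ⟨c, hc, rfl⟩
    rw [h] at this
    exact Subtype.ext (by simpa using this)
  have := hA (up I) (up J) ?_ ?_
  · exact this.imp (up_bot I) (up_bot J)
  · rw [disjoint_iff, LieSubmodule.eq_bot_iff]
    intro x hx
    obtain ⟨h1, h2⟩ := (LieSubmodule.mem_inf _ _ _).mp hx
    obtain ⟨c, hc, rfl⟩ := (mem_up _ _).mp h1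
    obtain ⟨d, hd, hdc⟩ := (mem_up _ _).mp h2
    obtain rfl : d = c := Subtype.ext hdc
    have : d ∈ I ⊓ J := (LieSubmodule.mem_inf _ _ _).mpr ⟨hc, hd⟩
    rw [hIJ] at this
    have h0 : d = 0 := by simpa using this
    simp [h0]
  · apply le_antisymm
    · apply sup_le
      · intro x hx
        obtain ⟨c, hc, rfl⟩ := (mem_up _ _).mp hx
        exact c.2
      · intro x hx
        obtain ⟨c, hc, rfl⟩ := (mem_up _ _).mp hx
        exact c.2
    · intro x hx
      have : (⟨x, hx⟩ : A) ∈ I ⊔ J := by rw [hIJ']; exact LieSubmodule.mem_top _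
      obtain ⟨c, hc, d, hd, hcd⟩ := (LieSubmodule.mem_sup _ _ _).mp this
      refine (LieSubmodule.mem_sup _ _ _).mpr ⟨c, (mem_up _ _).mpr ⟨c, hc, rfl⟩,
        d, (mem_up _ _).mpr ⟨d, hd, rfl⟩, ?_⟩
      exact congrArg Subtype.val hcd

lemma factor_of_indec {A B : LieIdeal K L} (h0 : A ≠ ⊥) (hB : IsCompl A B)
    (hA : IsIndecomposableLie K A) : IsFactor A := by
  refine ⟨h0, ⟨B, hB⟩, ?_⟩
  intro C D hCD hs
  have hC : C ≤ A := hs ▸ le_sup_left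
  have hD : D ≤ A := hs ▸ le_sup_right
  have mem_c : ∀ (I : LieIdeal K L) (x : A), x ∈ I.comap A.incl ↔ (x : L) ∈ I := by
    intro I x; exact LieIdeal.mem_comap
  have bot : ∀ I : LieIdeal K L, I ≤ A → I.comap A.incl = ⊥ → I = ⊥ := by
    intro I hI h
    rw [LieSubmodule.eq_bot_iff]
    intro x hx
    have : (⟨x, hI hx⟩ : A) ∈ I.comap A.incl := (mem_c _ _).mpr hx
    rw [h] at this
    simpa using this
  refine (hA (C.comap A.incl) (D.comap A.incl) ?_ ?_).imp (bot C hC) (bot D hD)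
  · rw [LieSubmodule.eq_bot_iff]
    intro x hx
    obtain ⟨h1, h2⟩ := (LieSubmodule.mem_inf _ _ _).mp hx
    have : (x : L) ∈ C ⊓ D := (LieSubmodule.mem_inf _ _ _).mpr ⟨(mem_c _ _).mp h1, (mem_c _ _).mp h2⟩
    rw [hCD.eq_bot] at this
    exact Subtype.ext (by simpa using this)
  · rw [eq_top_iff]
    rintro ⟨x, hx⟩ -
    have hx' := hx
    rw [← hs] at hx'
    obtain ⟨c, hc, d, hd, hcd⟩ := (LieSubmodule.mem_sup _ _ _).mp hx'
    exact (LieSubmodule.mem_sup _ _ _).mpr ⟨⟨c, hC hc⟩, (mem_c _ _).mpr hc,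
      ⟨d, hD hd⟩, (mem_c _ _).mpr hd, Subtype.ext hcd⟩

lemma factor_le_or (hcomm : ∀ f g : Module.End K L, InCentroid f → InCentroid g → f * g = g * f)
    {A C D : LieIdeal K L} (hA : IsFactor A) (h : IsCompl C D) : A ≤ C ∨ A ≤ D := by
  obtain ⟨-, ⟨B, hB⟩, hA⟩ := hA
  have hd := distrib hcomm hB h
  rcases hA _ _ (h.disjoint.mono inf_le_right inf_le_right) hd with h1 | h1
  · rw [h1, bot_sup_eq] at hd
    exact Or.inr (inf_eq_left.mp hd)
  · rw [h1, sup_bot_eq] at hd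
    exact Or.inl (inf_eq_left.mp hd)

lemma factor_le_compl (hcomm : ∀ f g : Module.End K L, InCentroid f → InCentroid g → f * g = g * f)
    {A B A' : LieIdeal K L} (hA : IsFactor A) (hA' : IsFactor A') (hne : A' ≠ A)
    (h : IsCompl A B) : A' ≤ B := by
  rcases factor_le_or hcomm hA' h with h1 | h1
  · obtain ⟨B', hB'⟩ := hA'.2.1
    rcases factor_le_or hcomm hA hB' with h2 | h2
    · exact absurd (le_antisymm h1 h2) hne
    · exact absurd (hB'.disjoint.eq_bot_of_le (h1.trans h2)) hA'.1
  · exact h1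

lemma le_sSup_factor [FiniteDimensional K L] (A : LieIdeal K L) :
    (∃ B, IsCompl A B) → A ≤ sSup {A : LieIdeal K L | IsFactor A} := by
  have : WellFoundedLT (LieIdeal K L) := LieSubmodule.wellFoundedLT_of_isArtinian K L L
  induction A using WellFoundedLT.induction with
  | ind A ih =>
    rintro ⟨B, hB⟩
    by_cases h0 : A = ⊥
    · rw [h0]; exact bot_le
    by_cases hf : IsFactor A
    · exact le_sSup hf
    have : ∃ C D : LieIdeal K L, Disjoint C D ∧ C ⊔ D = A ∧ C ≠ ⊥ ∧ D ≠ ⊥ := by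
      by_contra hcon
      push Not at hcon
      refine hf ⟨h0, ⟨B, hB⟩, fun C D h1 h2 => ?_⟩
      by_cases hC : C = ⊥
      · exact Or.inl hC
      · exact Or.inr (hcon C D h1 h2 hC)
    have key : ∀ C D : LieIdeal K L, Disjoint C D → C ⊔ D = A → D ≠ ⊥ →
        C ≤ sSup {A : LieIdeal K L | IsFactor A} := by
      intro C D hd hs hD
      apply ih C
      · refine lt_of_le_of_ne (hs ▸ le_sup_left) ?_
        rintro rfl
        exact hD (hd.symm.eq_bot_of_le (sup_eq_left.mp hs))
      · refine ⟨D ⊔ B, ?_, ?_⟩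
        · apply hd.disjoint_sup_right_of_disjoint_sup_left
          rw [hs]; exact hB.disjoint
        · rw [codisjoint_iff, ← sup_assoc, hs, hB.sup_eq_top]
    obtain ⟨C, D, hd, hs, hC, hD⟩ := this
    rw [← hs]
    exact sup_le (key C D hd hs hD) (key D C hd.symm (sup_comm C D ▸ hs) hC)

end Helpers

/-- A finite-dimensional Lie algebra with commutative centroid decomposes as an internal direct
sum of finitely many nonzero ideals, each indecomposable as a Lie algebra, and this
decomposition is unique except for the order. -/
theorem stmt_3 {K L : Type*} [Field K] [LieRing L] [LieAlgebra K L] [FiniteDimensional K L]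
    (hcomm : ∀ f g : Module.End K L, InCentroid f → InCentroid g → f * g = g * f) :
    ∃ (n : ℕ) (I : Fin n → LieIdeal K L),
      (∀ i, I i ≠ ⊥) ∧
      (∀ i, IsIndecomposableLie K (I i)) ∧
      DirectSum.IsInternal (fun i => (I i : Submodule K L)) ∧
      ∀ (m : ℕ) (J : Fin m → LieIdeal K L),
        (∀ j, J j ≠ ⊥) →
        (∀ j, IsIndecomposableLie K (J j)) →
        DirectSum.IsInternal (fun j => (J j : Submodule K L)) →
        m = n ∧ Set.range J = Set.range I := by
  classical
  set S : Set (LieIdeal K L) := {A | IsFactor A} with hS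
  have hind : sSupIndep S := by
    intro A hA
    obtain ⟨B, hB⟩ := hA.2.1
    refine hB.disjoint.mono_right (sSup_le ?_)
    rintro A' ⟨hA', hne⟩
    exact factor_le_compl hcomm hA hA' hne hB
  have htop : sSup S = ⊤ := top_le_iff.mp (le_sSup_factor ⊤ ⟨⊥, isCompl_top_bot⟩)
  have hfin : S.Finite := WellFoundedGT.finite_of_sSupIndep hind
  have : Finite S := hfin
  have e : Fin (Nat.card S) ≃ S := (Finite.equivFin S).symm
  have hrange : Set.range (fun i => (e i : LieIdeal K L)) = S := by
    ext A
    constructor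
    · rintro ⟨i, rfl⟩; exact (e i).2
    · intro hA; exact ⟨e.symm ⟨A, hA⟩, congrArg Subtype.val (e.apply_symm_apply ⟨A, hA⟩)⟩
  refine ⟨Nat.card S, fun i => (e i : LieIdeal K L), fun i => (e i).2.1,
    fun i => indec_of_factor (e i).2, ?_, ?_⟩
  · rw [DirectSum.isInternal_submodule_iff_iSupIndep_and_iSup_eq_top]
    refine ⟨LieSubmodule.iSupIndep_toSubmodule.mpr ?_,
      LieSubmodule.iSup_toSubmodule_eq_top.mpr ?_⟩
    · exact (sSupIndep_iff S).mp hind |>.comp e.injective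
    · exact (congrArg sSup hrange).trans htop
  · intro m J hJ0 hJ hint
    rw [DirectSum.isInternal_submodule_iff_iSupIndep_and_iSup_eq_top] at hint
    have hi : iSupIndep J := LieSubmodule.iSupIndep_toSubmodule.mp hint.1
    have ht : ⨆ j, J j = ⊤ := LieSubmodule.iSup_toSubmodule_eq_top.mp hint.2
    have hJS : ∀ j, IsFactor (J j) := by
      intro j
      refine factor_of_indec (hJ0 j) (B := ⨆ k, ⨆ (_ : k ≠ j), J k) ⟨hi j, ?_⟩ (hJ j)
      rw [codisjoint_iff, ← top_le_iff, ← ht]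
      refine iSup_le fun k => ?_
      by_cases hk : k = j
      · rw [hk]; exact le_sup_left
      · exact le_sup_of_le_right (le_iSup₂_of_le k hk le_rfl)
    have hJr : Set.range J = S := by
      apply Set.Subset.antisymm
      · rintro _ ⟨j, rfl⟩; exact hJS j
      · intro A hA
        by_contra hcon
        obtain ⟨B, hB⟩ := hA.2.1
        have hle : ⊤ ≤ B := by
          rw [← ht]
          refine iSup_le fun j => factor_le_compl hcomm hA (hJS j) ?_ hB
          rintro rfl
          exact hcon ⟨j, rfl⟩
        exact hA.1 (hB.disjoint.eq_bot_of_le (le_top.trans hle))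
    refine ⟨?_, hJr.trans hrange.symm⟩
    have := Nat.card_range_of_injective (hi.injective hJ0)
    rw [hJr] at this
    simpa using this.symm
end

section
/- Let 𝔤 be a nonzero finite-dimensional complex Lie algebra. Then 𝔤 is indecomposable if and only if every semisimple element of its centroid is a scalar multiple of the identity, i.e. S(𝔤) = ℂ·id. -/
open Polynomial in
theorem semisimple_of_idem_aux {V : Type*} [AddCommGroup V] [Module ℂ V]
    (p : Module.End ℂ V) (hp : p * p = p) : p.IsSemisimple := by
  apply Module.End.isSemisimple_of_squarefree_aeval_eq_zero (p := (X * (X - C 1) : ℂ[X]))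
  · apply Polynomial.Separable.squarefree
    apply Polynomial.Separable.mul Polynomial.separable_X (Polynomial.separable_X_sub_C)
    exact ⟨1, -1, by simp⟩
  · simp [mul_sub, hp]

/-- A nonzero finite-dimensional complex Lie algebra is indecomposable if and only if every
semisimple element of its centroid is a complex scalar multiple of the identity. -/
theorem stmt_5 {L : Type*} [LieRing L] [LieAlgebra ℂ L] [FiniteDimensional ℂ L] [Nontrivial L] :
    IsIndecomposableLie ℂ L ↔
      {f : Module.End ℂ L | InCentroid f ∧ f.IsSemisimple} =
        Set.range (fun c : ℂ => c • (1 : Module.End ℂ L)) := by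
  constructor
  · intro h
    apply Set.Subset.antisymm
    · rintro f ⟨hf, hs⟩
      obtain ⟨c, hc⟩ := Module.End.exists_eigenvalue f
      let g : Module.End ℂ L := f - algebraMap ℂ (Module.End ℂ L) c
      have hgs : g.IsSemisimple := Module.End.isSemisimple_sub_algebraMap_iff.2 hs
      have hg : ∀ x y : L, g ⁅x, y⁆ = ⁅x, g y⁆ := by
        intro x y
        simp [g, hf x y, Module.algebraMap_end_apply]
      let I : LieIdeal ℂ L :=
        { LinearMap.ker g with
          lie_mem := by
            intro x m hm
            change g ⁅x, m⁆ = 0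
            have hm' : g m = 0 := hm
            rw [hg, hm', lie_zero] }
      let J : LieIdeal ℂ L :=
        { LinearMap.range g with
          lie_mem := by
            rintro x m ⟨y, rfl⟩
            exact ⟨⁅x, y⁆, hg x y⟩ }
      have hIs : I.toSubmodule = LinearMap.ker g := rfl
      have hJs : J.toSubmodule = LinearMap.range g := rfl
      have hdis : Disjoint (LinearMap.ker g) (LinearMap.range g) := by
        obtain ⟨W, hW, hc⟩ := Module.End.isSemisimple_iff.1 hgs (LinearMap.ker g)
          (by intro x hx
              have hx' : g x = 0 := hx
              change g (g x) = 0
              rw [hx', map_zero])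
        refine hc.disjoint.mono_right ?_
        rintro _ ⟨y, rfl⟩
        have hy : y ∈ LinearMap.ker g ⊔ W := by rw [hc.sup_eq_top]; trivial
        obtain ⟨a, ha, b, hb, rfl⟩ := Submodule.mem_sup.1 hy
        have ha' : g a = 0 := ha
        rw [map_add, ha', zero_add]
        exact hW hb
      have hsup : LinearMap.ker g ⊔ LinearMap.range g = ⊤ := by
        apply Submodule.eq_top_of_disjoint _ _ _ hdis
        have := LinearMap.finrank_range_add_finrank_ker g
        omega
      have hI : I ≠ ⊥ := by
        intro h0
        obtain ⟨v, hv⟩ := hc.exists_hasEigenvector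
        have : v ∈ I := by
          change g v = 0
          simp [g, hv.apply_eq_smul, Module.algebraMap_end_apply]
        rw [h0, LieSubmodule.mem_bot] at this
        exact hv.2 this
      have hJ : J = ⊥ := by
        refine (h I J ?_ ?_).resolve_left hI
        · rw [← LieSubmodule.toSubmodule_inj, LieSubmodule.inf_toSubmodule, hIs, hJs, hdis.eq_bot]
          rfl
        · rw [← LieSubmodule.toSubmodule_inj, LieSubmodule.sup_toSubmodule, hIs, hJs, hsup]
          rfl
      refine ⟨c, ?_⟩
      ext x
      have : g x ∈ J := ⟨x, rfl⟩
      rw [hJ, LieSubmodule.mem_bot] at this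
      simp only [g, LinearMap.sub_apply, Module.algebraMap_end_apply, sub_eq_zero] at this
      simp [this]
    · rintro _ ⟨c, rfl⟩
      refine ⟨?_, ?_⟩
      · intro x y
        simp
      · exact Module.End.IsSemisimple_smul c Module.End.isSemisimple_id
  · intro h I J hinf hsup
    have hc : IsCompl I.toSubmodule J.toSubmodule := by
      constructor
      · rw [disjoint_iff, ← LieSubmodule.inf_toSubmodule, hinf]; rfl
      · rw [codisjoint_iff, ← LieSubmodule.sup_toSubmodule, hsup]; rfl
    have key : ∃ p : Module.End ℂ L, (∀ x ∈ I, p x = x) ∧ (∀ x ∈ J, p x = 0) := by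
      refine ⟨I.toSubmodule.subtype ∘ₗ I.toSubmodule.projectionOnto J.toSubmodule hc, ?_, ?_⟩
      · intro x hx
        have := Submodule.projectionOnto_apply_left hc ⟨x, hx⟩
        simpa using congrArg Subtype.val this
      · intro x hx
        have := Submodule.projectionOnto_apply_right hc ⟨x, hx⟩
        simpa using congrArg Subtype.val this
    obtain ⟨p, hpI, hpJ⟩ := key
    have hdec : ∀ y : L, ∃ a ∈ I, ∃ b ∈ J, a + b = y := by
      intro y
      have hy : y ∈ I.toSubmodule ⊔ J.toSubmodule := by rw [hc.sup_eq_top]; trivial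
      exact Submodule.mem_sup.1 hy
    have hmem : p ∈ {f : Module.End ℂ L | InCentroid f ∧ f.IsSemisimple} := by
      refine ⟨?_, semisimple_of_idem_aux p ?_⟩
      · intro x y
        obtain ⟨a, ha, b, hb, rfl⟩ := hdec y
        rw [lie_add, map_add, map_add, hpI a ha, hpJ b hb, hpI _ (I.lie_mem ha),
          hpJ _ (J.lie_mem hb), add_zero, add_zero]
      · ext y
        obtain ⟨a, ha, b, hb, rfl⟩ := hdec y
        simp [hpI a ha, hpJ b hb]
    rw [h] at hmem
    obtain ⟨c, rfl⟩ := hmem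
    by_cases h0 : c = 0
    · left
      rw [LieSubmodule.eq_bot_iff]
      intro x hx
      have := hpI x hx
      simpa [h0] using this.symm
    · right
      rw [LieSubmodule.eq_bot_iff]
      intro x hx
      have := hpJ x hx
      simpa [h0] using this
end

section
/- Let V be a finite-dimensional real vector space, m ∈ ℕ, s ∈ ℕ, x₀ ∈ ℝ^m, and let f : ℝ^m → V be a smooth map whose i-th iterated derivative at x₀ vanishes for every i ≤ s (i.e. the s-jet of f at x₀ is zero: f(x₀) = 0 and iteratedFDeriv ℝ i f x₀ = 0 for all 1 ≤ i ≤ s). Then there exist r ∈ ℕ, smooth functions a₁, …, a_r : ℝ^m → ℝ with aᵢ(x₀) = 0 for all i, and smooth maps A₁, …, A_r : ℝ^m → V such that f(y) = Σ_{i=1}^r aᵢ(y)^{s+1} · Aᵢ(y) for all y ∈ ℝ^m. -/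
universe u

open MeasureTheory in
lemma contDiff_param_integral_nat {E : Type} [NormedAddCommGroup E] [NormedSpace ℝ E]
    [FiniteDimensional ℝ E] (n : ℕ) : ∀ {F : Type u} [NormedAddCommGroup F] [NormedSpace ℝ F]
    (H : E × ℝ → F), ContDiff ℝ (⊤ : ℕ∞) H →
    ContDiff ℝ n (fun x => ∫ t in (0:ℝ)..1, H (x, t)) := by
  induction n with
  | zero =>
    intro F _ _ H hH
    rw [Nat.cast_zero, contDiff_zero]
    exact intervalIntegral.continuous_parametric_intervalIntegral_of_continuous'
      (f := fun x t => H (x, t)) (by simpa [Function.uncurry_def] using hH.continuous) 0 1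
  | succ n ih =>
    intro F _ _ H hH
    rw [Nat.cast_add, Nat.cast_one, contDiff_succ_iff_hasFDerivAt]
    have hfd : ContDiff ℝ (⊤ : ℕ∞) (fun p : E × ℝ =>
        (fderiv ℝ H p).comp (ContinuousLinearMap.inl ℝ E ℝ)) :=
      (hH.fderiv_right (m := (⊤ : ℕ∞)) (by simp)).clm_comp contDiff_const
    refine ⟨fun x => ∫ t in (0:ℝ)..1,
      (fderiv ℝ H (x, t)).comp (ContinuousLinearMap.inl ℝ E ℝ), ih _ hfd, fun x₀ => ?_⟩
    have hdiff : Differentiable ℝ H := hH.differentiable (by simp)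
    obtain ⟨C, hC⟩ := ((isCompact_closedBall x₀ (1:ℝ)).prod
      (isCompact_Icc (a := (0:ℝ)) (b := 1))).exists_bound_of_continuousOn hfd.continuous.continuousOn
    refine intervalIntegral.hasFDerivAt_integral_of_dominated_of_fderiv_le
      (F := fun x t => H (x, t))
      (F' := fun x t => (fderiv ℝ H (x, t)).comp (ContinuousLinearMap.inl ℝ E ℝ))
      (bound := fun _ => C) (s := Metric.closedBall x₀ 1)
      (Metric.closedBall_mem_nhds x₀ one_pos) ?_ ?_ ?_ ?_ ?_ ?_
    · refine Filter.Eventually.of_forall fun x => ?_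
      have : Continuous (fun t : ℝ => H (x, t)) := hH.continuous.comp (by fun_prop)
      exact this.aestronglyMeasurable
    · have : Continuous (fun t : ℝ => H (x₀, t)) := hH.continuous.comp (by fun_prop)
      exact this.intervalIntegrable _ _
    · have : Continuous (fun t : ℝ =>
        (fderiv ℝ H (x₀, t)).comp (ContinuousLinearMap.inl ℝ E ℝ)) :=
        hfd.continuous.comp (f := fun t : ℝ => (x₀, t)) (by fun_prop)
      exact this.aestronglyMeasurable
    · refine Filter.Eventually.of_forall fun t ht x hx => ?_
      rw [Set.uIoc_of_le zero_le_one] at ht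
      exact hC (x, t) ⟨hx, ht.1.le, ht.2⟩
    · exact intervalIntegrable_const
    · refine Filter.Eventually.of_forall fun t _ x _ => ?_
      exact (hdiff (x, t)).hasFDerivAt.comp x (hasFDerivAt_prodMk_left x t)

lemma contDiff_param_integral {E : Type} [NormedAddCommGroup E] [NormedSpace ℝ E]
    [FiniteDimensional ℝ E] {F : Type u} [NormedAddCommGroup F] [NormedSpace ℝ F]
    (H : E × ℝ → F) (hH : ContDiff ℝ (⊤ : ℕ∞) H) :
    ContDiff ℝ (⊤ : ℕ∞) (fun x => ∫ t in (0:ℝ)..1, H (x, t)) :=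
  contDiff_infty.2 fun n => contDiff_param_integral_nat n H hH

def sg (b : Bool) : ℝ := if b then 1 else -1

lemma polar_aux (n : ℕ) (g : Fin n → Fin n) :
    ∑ e : Fin n → Bool, (∏ j, sg (e j)) * ∏ k, sg (e (g k)) =
      if Function.Bijective g then 2 ^ n else 0 := by
  split_ifs with hg
  · have : ∀ e : Fin n → Bool, (∏ j, sg (e j)) * ∏ k, sg (e (g k)) = 1 := by
      intro e
      rw [hg.prod_comp (fun k => sg (e k)), ← Finset.prod_mul_distrib]
      refine Finset.prod_eq_one fun j _ => ?_
      unfold sg; split_ifs <;> norm_num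
    simp [this]
  · have hs : ¬ Function.Surjective g := fun h => hg (Finite.injective_iff_bijective.1
      (Finite.injective_iff_surjective.2 h))
    simp only [Function.Surjective, not_forall, not_exists] at hs
    obtain ⟨j, hj⟩ := hs
    refine Finset.sum_involution (fun e _ => Function.update e j (!(e j))) ?_ ?_ ?_ ?_
    · intro e _
      have h1 : ∏ k, sg (Function.update e j (!(e j)) (g k)) = ∏ k, sg (e (g k)) :=
        Finset.prod_congr rfl fun k _ => by rw [Function.update_of_ne (hj k)]
      have h2 : ∏ k, sg (Function.update e j (!(e j)) k) = - ∏ k, sg (e k) := by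
        rw [← Finset.mul_prod_erase _ _ (Finset.mem_univ j),
          ← Finset.mul_prod_erase _ (fun k => sg (e k)) (Finset.mem_univ j)]
        rw [Finset.prod_congr rfl (g := fun k => sg (e k)) fun k hk => by
          rw [Function.update_of_ne (Finset.ne_of_mem_erase hk)]]
        simp only [Function.update_self]
        cases e j <;> simp [sg]
      rw [h1, h2]; ring
    · intro e _ _ h
      have := congrFun h j
      simp at this
    · intro e _; exact Finset.mem_univ _
    · intro e _; simp

lemma polar (n : ℕ) (x : Fin n → ℝ) :
    ∑ e : Fin n → Bool, (∏ j, sg (e j)) * (∑ j, sg (e j) * x j) ^ n =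
      (2 ^ n * n.factorial) * ∏ j, x j := by
  classical
  have h1 : ∀ e : Fin n → Bool, (∑ j, sg (e j) * x j) ^ n =
      ∑ g : Fin n → Fin n, (∏ k, sg (e (g k))) * ∏ k, x (g k) := by
    intro e
    have := Finset.prod_univ_sum (fun _ : Fin n => (Finset.univ : Finset (Fin n)))
      (fun _ j => sg (e j) * x j)
    simp only [Finset.prod_const, Finset.card_univ, Fintype.card_fin,
      Fintype.piFinset_univ, Finset.prod_mul_distrib] at this
    exact this
  simp_rw [h1, Finset.mul_sum, ← mul_assoc]
  rw [Finset.sum_comm]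
  simp_rw [← Finset.sum_mul, polar_aux, ite_mul, zero_mul]
  rw [← Finset.sum_filter]
  have h2 : ∀ g ∈ Finset.univ.filter (fun g : Fin n → Fin n => Function.Bijective g),
      (2:ℝ) ^ n * ∏ k, x (g k) = 2 ^ n * ∏ k, x k := by
    intro g hg
    rw [(Finset.mem_filter.1 hg).2.prod_comp x]
  rw [Finset.sum_congr rfl h2, Finset.sum_const, nsmul_eq_mul]
  have h3 : (Finset.univ.filter (fun g : Fin n → Fin n => Function.Bijective g)).card
      = n.factorial := by
    rw [← Fintype.card_subtype, ← Fintype.card_congr (Equiv.ofBijective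
      (fun p : Equiv.Perm (Fin n) =>
        (⟨p, p.bijective⟩ : {g : Fin n → Fin n // Function.Bijective g}))
      ⟨fun p q h => Equiv.ext (congrFun (Subtype.ext_iff.1 h)),
        fun g => ⟨Equiv.ofBijective g.1 g.2, rfl⟩⟩), Fintype.card_perm, Fintype.card_fin]
  rw [h3]; ring

/-- **Taylor-type lemma.**  If `f : ℝ^m → V` is a smooth map into a finite-dimensional real
vector space whose `s`-jet vanishes at `x₀` (i.e. `f x₀ = 0` and all iterated derivatives of
order `1 ≤ i ≤ s` vanish at `x₀`), then `f` is a finite sum `Σᵢ aᵢ^(s+1) • Aᵢ` with `aᵢ`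
smooth real-valued functions vanishing at `x₀` and `Aᵢ` smooth `V`-valued maps. -/
theorem stmt_8 {V : Type*} [NormedAddCommGroup V] [NormedSpace ℝ V] [FiniteDimensional ℝ V]
    {m s : ℕ} (x₀ : EuclideanSpace ℝ (Fin m)) (f : EuclideanSpace ℝ (Fin m) → V)
    (hf : ContDiff ℝ (⊤ : ℕ∞) f) (h0 : f x₀ = 0)
    (hjet : ∀ i : ℕ, 1 ≤ i → i ≤ s → iteratedFDeriv ℝ i f x₀ = 0) :
    ∃ (r : ℕ) (a : Fin r → EuclideanSpace ℝ (Fin m) → ℝ)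
      (A : Fin r → EuclideanSpace ℝ (Fin m) → V),
      (∀ i, ContDiff ℝ (⊤ : ℕ∞) (a i)) ∧
      (∀ i, a i x₀ = 0) ∧
      (∀ i, ContDiff ℝ (⊤ : ℕ∞) (A i)) ∧
      ∀ y, f y = ∑ i, (a i y) ^ (s + 1) • A i y := by
  classical
  let b : Fin m → EuclideanSpace ℝ (Fin m) := fun i => EuclideanSpace.single i 1
  let G : (Fin (s + 1) → Fin m) → EuclideanSpace ℝ (Fin m) → V := fun k y =>
    ∫ t in (0:ℝ)..1, (1 - t) ^ s •
      iteratedFDeriv ℝ (s + 1) f (x₀ + t • (y - x₀)) (fun j => b (k j))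
  have hD : ContDiff ℝ (⊤ : ℕ∞) (iteratedFDeriv ℝ (s + 1) f) :=
    hf.iteratedFDeriv_right (m := (⊤ : ℕ∞)) (by exact_mod_cast le_top)
  have hH : ∀ k : Fin (s + 1) → Fin m, ContDiff ℝ (⊤ : ℕ∞) (fun p : EuclideanSpace ℝ (Fin m) × ℝ => (1 - p.2) ^ s •
      iteratedFDeriv ℝ (s + 1) f (x₀ + p.2 • (p.1 - x₀)) (fun j => b (k j))) := by
    intro k
    have h1 : ContDiff ℝ (⊤ : ℕ∞) (fun p : EuclideanSpace ℝ (Fin m) × ℝ =>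
        iteratedFDeriv ℝ (s + 1) f (x₀ + p.2 • (p.1 - x₀))) := hD.comp (by fun_prop)
    have h2 : ContDiff ℝ (⊤ : ℕ∞) (fun p : EuclideanSpace ℝ (Fin m) × ℝ => (1 - p.2) ^ s) := by fun_prop
    exact h2.smul ((ContinuousMultilinearMap.apply ℝ (fun _ : Fin (s + 1) => EuclideanSpace ℝ (Fin m)) V
      (fun j => b (k j))).contDiff.comp h1)
  have hG : ∀ k, ContDiff ℝ (⊤ : ℕ∞) (G k) := fun k => contDiff_param_integral _ (hH k)
  have key : ∀ y, f y = ∑ k : Fin (s + 1) → Fin m,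
      (∏ j, (y - x₀) (k j)) • ((s.factorial : ℝ)⁻¹ • G k y) := by
    intro y
    have hT := map_add_eq_sum_add_integral_iteratedFDeriv (f := f) (x := x₀) (y := y - x₀) (n := s)
      (fun t _ => (hf.of_le (by exact_mod_cast le_top)).contDiffAt)
    rw [add_sub_cancel, Finset.sum_eq_zero, zero_add] at hT
    · rw [hT]
      simp_rw [smul_comm _ ((s.factorial : ℝ)⁻¹), ← Finset.smul_sum]
      congr 1
      simp only [G]
      simp_rw [← intervalIntegral.integral_smul]
      rw [← intervalIntegral.integral_finsetSum]
      · refine intervalIntegral.integral_congr fun t _ => ?_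
        have hv : (y - x₀) = ∑ i, (y - x₀) i • b i := by
          ext i
          simp [b, Pi.single_apply]
        have hexp : ∀ M : (EuclideanSpace ℝ (Fin m)) [×(s+1)]→L[ℝ] V, M (fun _ => y - x₀) =
            ∑ k : Fin (s + 1) → Fin m, (∏ j, (y - x₀) (k j)) • M (fun j => b (k j)) := by
          intro M
          conv_lhs => rw [hv]
          rw [M.map_sum (fun _ i => (y - x₀) i • b i)]
          refine Finset.sum_congr rfl fun k _ => ?_
          exact M.map_smul_univ (fun j => (y - x₀) (k j)) (fun j => b (k j))
        rw [hexp, Finset.smul_sum]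
        exact Finset.sum_congr rfl fun k _ => smul_comm _ _ _
      · intro k _
        apply Continuous.intervalIntegrable
        exact ((hH k).continuous.comp (f := fun t : ℝ => (y, t)) (by fun_prop)).const_smul _
    · intro i hi
      rcases Nat.eq_zero_or_pos i with rfl | hpos
      · simp [h0]
      · rw [hjet i hpos (by have := Finset.mem_range.1 hi; omega)]; simp
  let ι := (Fin (s + 1) → Fin m) × (Fin (s + 1) → Bool)
  let φ : Fin (Fintype.card ι) ≃ ι := (Fintype.equivFin ι).symm
  let a : ι → EuclideanSpace ℝ (Fin m) → ℝ := fun p y => ∑ j, sg (p.2 j) * (y - x₀) (p.1 j)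
  let c : ℝ := 2 ^ (s + 1) * (s + 1).factorial
  have hc : c ≠ 0 := by positivity
  let A : ι → EuclideanSpace ℝ (Fin m) → V := fun p y =>
    (c⁻¹ * ∏ j, sg (p.2 j)) • ((s.factorial : ℝ)⁻¹ • G p.1 y)
  refine ⟨Fintype.card ι, fun i => a (φ i), fun i => A (φ i), fun i => ?_, fun i => ?_,
    fun i => ?_, fun y => ?_⟩
  · simp only [a]; fun_prop
  · simp [a]
  · exact ((hG _).const_smul _).const_smul _
  · rw [φ.sum_comp (fun p => a p y ^ (s + 1) • A p y), Fintype.sum_prod_type, key y]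
    refine Finset.sum_congr rfl fun k _ => ?_
    simp only [a, A]
    simp_rw [smul_smul]
    rw [← Finset.sum_smul]
    congr 1
    have hp := polar (s + 1) (fun j => (y - x₀) (k j))
    have : ∏ j, (y - x₀) (k j) = c⁻¹ * (c * ∏ j, (y - x₀) (k j)) := by
      rw [inv_mul_cancel_left₀ hc]
    rw [this, ← hp, Finset.mul_sum, Finset.sum_mul]
    exact Finset.sum_congr rfl fun e _ => by ring
end
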